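/- Let W_Br' = W̄ ∪ {a_1, a_2} \ {ε} and let W_Br ⊆ W_Br' contain exactly one of {w, w^{-1}} for each w ∈ W_Br'. Then the classes {φ̂_w : w ∈ W_Br} of Brooks quasimorphisms form a basis of the quotient B̂r(F_n) of the Brooks space by bounded functions. -/

import Mathlib

open List Finset

/-- Number of occurrences of `w` as a contiguous subword of `v`. -/
def occ {α : Type*} [DecidableEq α] (w v : List α) : ℕ :=
  ((List.range (v.length + 1 - w.length)).filter (fun i => decide (w <+: v.drop i))).length

/-- Elementary counting function, with the convention `p_ε(v) = |v|`. -/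
def cnt {α : Type*} [DecidableEq α] (w v : List α) : ℚ :=
  if w = [] then v.length else occ w v

/-- The inverse of a letter of `S̄`: letters are pairs (generator, sign). -/
def invL {n : ℕ} (a : Fin n × Bool) : Fin n × Bool := (a.1, !a.2)

/-- The inverse of a (reduced) word. -/
def invW {n : ℕ} (w : List (Fin n × Bool)) : List (Fin n × Bool) := (w.map invL).reverse

def redB {n : ℕ} : List (Fin n × Bool) → Bool
  | a :: b :: t => decide (b ≠ invL a) && redB (b :: t)
  | _ => true

/-- A word over `S̄` is reduced if no letter is followed by its inverse. -/
def Red {n : ℕ} (w : List (Fin n × Bool)) : Prop := redB w = true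

instance {n : ℕ} : DecidablePred (Red (n := n)) := fun _ => instDecidableEqBool _ _

/-- Left extension relation `l_w = p_w - Σ_{s : sw reduced} p_{sw}`. -/
def lgrp {n : ℕ} (w v : List (Fin n × Bool)) : ℚ :=
  cnt w v - ∑ s ∈ Finset.univ.filter (fun s => Red (s :: w)), cnt (s :: w) v

/-- Right extension relation `r_w = p_w - Σ_{s : ws reduced} p_{ws}`. -/
def rgrp {n : ℕ} (w v : List (Fin n × Bool)) : ℚ :=
  cnt w v - ∑ s ∈ Finset.univ.filter (fun s => Red (w ++ [s])), cnt (w ++ [s]) v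

/-- The map `σ₁` sending a function on F_n to `f - f ∘ (·⁻¹)`; on counting functions
it sends `p_w` to the Brooks quasimorphism `φ_w = p_w - p_{w⁻¹}`. -/
def sig1 {n : ℕ} (f : List (Fin n × Bool) → ℚ) : List (Fin n × Bool) → ℚ :=
  fun v => f v - f (invW v)

/-- The Brooks quasimorphism `φ_w = p_w - p_{w⁻¹}` of a nonempty reduced word. -/
def brooks {n : ℕ} (w v : List (Fin n × Bool)) : ℚ := (occ w v : ℚ) - (occ (invW w) v : ℚ)

/-- The set W̄' of reduced words (including ε) with `w₁ ≠ a₁`, `w₁w₂ ≠ a₂a₁⁻¹`,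
`w_fin ≠ a₁⁻¹`, `w_{fin-1}w_fin ≠ a₁a₂⁻¹`. -/
def WbarAux (n : ℕ) (hn : 2 ≤ n) : Set (List (Fin n × Bool)) :=
  {w | Red w ∧ w.head? ≠ some ((⟨0, by omega⟩ : Fin n), true) ∧
    w.take 2 ≠ [((⟨1, hn⟩ : Fin n), true), ((⟨0, by omega⟩ : Fin n), false)] ∧
    w.getLast? ≠ some ((⟨0, by omega⟩ : Fin n), false) ∧
    w.reverse.take 2 ≠ [((⟨1, hn⟩ : Fin n), false), ((⟨0, by omega⟩ : Fin n), true)]}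

/-- The set W̄ = (W̄' ∪ {a₁⁻¹}) \ {a₂}. -/
def Wbar (n : ℕ) (hn : 2 ≤ n) : Set (List (Fin n × Bool)) :=
  (WbarAux n hn ∪ {[((⟨0, by omega⟩ : Fin n), false)]}) \ {[((⟨1, hn⟩ : Fin n), true)]}

section Helpers

variable {n : ℕ}

abbrev Wd (n : ℕ) := List (Fin n × Bool)

theorem red_iff (w : Wd n) : Red w ↔ List.IsChain (fun a b => b ≠ invL a) w := by
  unfold Red
  induction w with
  | nil => simp [redB]
  | cons a t ih =>
    cases t with
    | nil => simp [redB]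
    | cons b t => simp [redB, ih, List.isChain_cons_cons]

@[simp] theorem invL_invL (a : Fin n × Bool) : invL (invL a) = a := by simp [invL]

theorem invL_inj {a b : Fin n × Bool} (h : invL a = invL b) : a = b := by
  rw [← invL_invL a, h, invL_invL]

theorem invL_ne (a : Fin n × Bool) : invL a ≠ a := by
  intro h
  have := congrArg Prod.snd h
  simp [invL] at this

@[simp] theorem invW_invW (w : Wd n) : invW (invW w) = w := by
  simp [invW, Function.comp_def]

theorem invW_cons (a : Fin n × Bool) (w : Wd n) : invW (a :: w) = invW w ++ [invL a] := by
  simp [invW]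

theorem invW_eq_nil {w : Wd n} : invW w = [] ↔ w = [] := by simp [invW]

theorem length_invW (w : Wd n) : (invW w).length = w.length := by simp [invW]

theorem red_invW {w : Wd n} (h : Red w) : Red (invW w) := by
  rw [red_iff] at *
  unfold invW
  rw [List.isChain_reverse, List.isChain_map]
  refine h.imp ?_
  intro a b hab h2
  simp at h2
  exact hab h2.symm

theorem red_cons {a b : Fin n × Bool} {t : Wd n} :
    Red (a :: b :: t) ↔ b ≠ invL a ∧ Red (b :: t) := by
  simp [red_iff, List.isChain_cons_cons]

theorem red_tail {a : Fin n × Bool} {t : Wd n} (h : Red (a :: t)) : Red t := by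
  rw [red_iff] at *; exact h.tail

theorem red_glue {v z r : Wd n} (h1 : Red (v ++ z)) (h2 : Red (z ++ r)) (hz : z ≠ []) :
    Red (v ++ z ++ r) := by
  rw [red_iff] at *
  rw [List.isChain_append] at *
  refine ⟨List.isChain_append.2 h1, h2.2.1, ?_⟩
  intro x hx y hy
  refine h2.2.2 x ?_ y hy
  rwa [List.getLast?_append_of_ne_nil _ hz] at hx

theorem exists_conn (hn : 2 ≤ n) (s t : Fin n × Bool) :
    ∃ m, Red [s, m, t] := by
  obtain ⟨m, hm⟩ : ∃ m : Fin n × Bool, m ∉ ({invL s, invL t} : Finset (Fin n × Bool)) := by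
    by_contra! h
    have h1 := Finset.card_le_card (show (Finset.univ : Finset (Fin n × Bool)) ⊆ _ from
      fun x _ => h x)
    have h2 := Finset.card_le_two (a := invL s) (b := invL t)
    simp at h1
    omega
  simp at hm
  refine ⟨m, ?_⟩
  rw [red_cons, red_cons]
  refine ⟨hm.1, ?_, by simp [Red, redB]⟩
  intro h
  apply hm.2
  rw [h, invL_invL]

theorem occ_nil {w : Wd n} (hw : w ≠ []) : occ w [] = 0 := by
  have : 0 < w.length := List.length_pos_iff.2 hw
  unfold occ
  have : ([] : Wd n).length + 1 - w.length = 0 := by simp; omega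
  rw [this]; rfl

theorem occ_cons {w : Wd n} (hw : w ≠ []) (a : Fin n × Bool) (v : Wd n) :
    occ w (a :: v) = (if w <+: a :: v then 1 else 0) + occ w v := by
  have hpos : 0 < w.length := List.length_pos_iff.2 hw
  unfold occ
  by_cases hl : w.length ≤ v.length + 1
  · have : (a :: v).length + 1 - w.length = (v.length + 1 - w.length) + 1 := by
      simp; omega
    rw [this, List.range_succ_eq_map, List.filter_cons, List.filter_map]
    by_cases h : w <+: a :: v
    · simp [h, Function.comp_def, Nat.add_comm]
    · simp [h, Function.comp_def]
  · have h1 : (a :: v).length + 1 - w.length = 0 := by simp; omega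
    have h2 : v.length + 1 - w.length = 0 := by omega
    have h3 : ¬ w <+: a :: v := by
      intro h
      have := h.length_le
      simp at this; omega
    rw [h1, h2]; simp [h3]

/-! ### Extension relations -/

theorem occ_left {w : Wd n} (hw : w ≠ []) (v : Wd n) (hv : Red v) :
    (occ w v : ℚ) = ∑ s ∈ Finset.univ.filter (fun s => Red (s :: w)), (occ (s :: w) v : ℚ)
      + (if w <+: v then 1 else 0) := by
  induction v with
  | nil =>
    simp [occ_nil hw, occ_nil (List.cons_ne_nil _ w), hw]
  | cons a v ih =>
    have ih := ih (red_tail hv)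
    rw [occ_cons hw]
    simp only [occ_cons (List.cons_ne_nil _ w)]
    push_cast
    rw [Finset.sum_add_distrib, ih]
    have key : ∑ s ∈ Finset.univ.filter (fun s => Red (s :: w)),
        (if s :: w <+: a :: v then (1 : ℚ) else 0) = if w <+: v then 1 else 0 := by
      by_cases h : w <+: v
      · have hr : Red (a :: w) := by
          rw [red_iff] at *
          exact hv.prefix (by simpa using h)
        rw [Finset.sum_eq_single a]
        · simp [h]
        · intro b _ hb
          simp [hb]
        · intro hh
          simp [hr] at hh
      · simp [h]
    rw [key]; ring

theorem occ_right {w : Wd n} (hw : w ≠ []) (v : Wd n) (hv : Red v) :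
    (occ w v : ℚ) = ∑ s ∈ Finset.univ.filter (fun s => Red (w ++ [s])), (occ (w ++ [s]) v : ℚ)
      + (if w <:+ v then 1 else 0) := by
  have hne : ∀ s, w ++ [s] ≠ [] := by simp
  induction v with
  | nil =>
    simp [occ_nil hw, occ_nil (hne _), hw]
  | cons a v ih =>
    have ih := ih (red_tail hv)
    rw [occ_cons hw]
    simp only [occ_cons (hne _)]
    push_cast
    rw [Finset.sum_add_distrib, ih]
    have key : ∑ s ∈ Finset.univ.filter (fun s => Red (w ++ [s])),
        (if w ++ [s] <+: a :: v then (1 : ℚ) else 0) =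
          if w <+: a :: v ∧ w ≠ a :: v then 1 else 0 := by
      by_cases h : w <+: a :: v ∧ w ≠ a :: v
      · obtain ⟨⟨t, ht⟩, h2⟩ := h
        cases t with
        | nil => simp at ht; exact absurd ht h2
        | cons b t =>
          have hp : w ++ [b] <+: a :: v := ⟨t, by rw [← ht]; simp⟩
          have hr : Red (w ++ [b]) := by
            rw [red_iff] at *
            exact hv.prefix hp
          rw [Finset.sum_eq_single b, if_pos hp, if_pos ⟨⟨_, ht⟩, h2⟩]
          · intro s _ hs
            rw [if_neg]
            rintro ⟨t', ht'⟩
            rw [← ht] at ht'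
            simp at ht'
            exact hs ht'.1
          · intro hh
            simp [hr] at hh
      · rw [if_neg h]
        apply Finset.sum_eq_zero
        intro s _
        rw [if_neg]
        intro hp
        apply h
        refine ⟨(List.prefix_append w [s]).trans hp, ?_⟩
        rintro rfl
        have := hp.length_le
        simp at this
    rw [key]
    by_cases h : w = a :: v
    · subst h
      have : ¬ (a :: v <:+ v) := fun h => by simpa using h.length_le
      simp [this, add_comm]
    · have : w <:+ a :: v ↔ w <:+ v := by
        rw [List.suffix_cons_iff]; simp [h]
      simp only [this]
      simp [h]; ring

/-- Functions bounded on reduced words. -/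
def bddSub (n : ℕ) : Submodule ℚ (Wd n → ℚ) where
  carrier := {f | ∃ C : ℚ, ∀ v, Red v → |f v| ≤ C}
  add_mem' := by
    rintro f g ⟨C, hC⟩ ⟨D, hD⟩
    exact ⟨C + D, fun v hv => (abs_add_le _ _).trans (add_le_add (hC v hv) (hD v hv))⟩
  zero_mem' := ⟨0, by simp⟩
  smul_mem' := by
    rintro c f ⟨C, hC⟩
    refine ⟨|c| * C, fun v hv => ?_⟩
    simp only [Pi.smul_apply, smul_eq_mul, abs_mul]
    exact mul_le_mul_of_nonneg_left (hC v hv) (abs_nonneg _)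

theorem brooks_invW (w : Wd n) : brooks (invW w) = - brooks w := by
  ext v; simp [brooks]

theorem brooks_left {w : Wd n} (hw : w ≠ []) :
    brooks w - ∑ s ∈ Finset.univ.filter (fun s => Red (s :: w)), brooks (s :: w)
      ∈ bddSub n := by
  refine ⟨2, fun v hv => ?_⟩
  have h1 := occ_left hw v hv
  have h2 := occ_right (w := invW w) (by simpa [invW_eq_nil] using hw) v hv
  have h3 : ∑ s ∈ Finset.univ.filter (fun s => Red (invW w ++ [s])), (occ (invW w ++ [s]) v : ℚ)
      = ∑ s ∈ Finset.univ.filter (fun s => Red (s :: w)), (occ (invW (s :: w)) v : ℚ) := by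
    refine Finset.sum_bij' (fun s _ => invL s) (fun s _ => invL s) ?_ ?_ ?_ ?_ ?_
    · intro s hs
      simp only [Finset.mem_filter, Finset.mem_univ, true_and] at *
      have := red_invW hs
      rw [← invL_invL s, ← invW_cons, invW_invW] at this
      exact this
    · intro s hs
      simp only [Finset.mem_filter, Finset.mem_univ, true_and] at *
      rw [← invW_cons]; exact red_invW hs
    · simp
    · simp
    · intro s _
      rw [invW_cons, invL_invL]
  rw [h3] at h2
  have : (brooks w - ∑ s ∈ Finset.univ.filter (fun s => Red (s :: w)), brooks (s :: w)) v
      = (if w <+: v then 1 else 0) - (if invW w <:+ v then 1 else 0) := by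
    simp only [Pi.sub_apply, Finset.sum_apply, brooks, Finset.sum_sub_distrib]
    rw [h1, h2]; ring
  rw [this]
  split_ifs <;> norm_num

/-! ### Good and bad words -/

def A1 (hn : 2 ≤ n) : Fin n × Bool := (⟨0, by omega⟩, true)
def A2 (hn : 2 ≤ n) : Fin n × Bool := (⟨1, hn⟩, true)

def badL (hn : 2 ≤ n) (w : Wd n) : Prop :=
  w.head? = some (A1 hn) ∨ w.take 2 = [A2 hn, invL (A1 hn)]

theorem A2_ne (hn : 2 ≤ n) : A2 hn ≠ A1 hn := by simp [A1, A2]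

theorem A2_ne' (hn : 2 ≤ n) : A2 hn ≠ invL (A1 hn) := by simp [A1, A2, invL]

def TT (n : ℕ) (hn : 2 ≤ n) : Set (Wd n) := (Wbar n hn ∪
      {[((⟨0, by omega⟩ : Fin n), true)], [((⟨1, hn⟩ : Fin n), true)]}) \ {[]}

theorem mem_aux (hn : 2 ≤ n) (w : Wd n) :
    w ∈ WbarAux n hn ↔ Red w ∧ ¬ badL hn w ∧ ¬ badL hn (invW w) := by
  have h1 : w.getLast? = some ((⟨0, by omega⟩ : Fin n), false) ↔
      (invW w).head? = some (A1 hn) := by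
    unfold invW
    rw [List.head?_reverse, List.getLast?_map]
    cases w.getLast? with
    | none => simp
    | some a =>
      simp only [Option.map_some, Option.some.injEq]
      constructor
      · rintro rfl; simp [invL, A1]
      · intro h; rw [← invL_invL a, h]; simp [invL, A1]
  have h2 : w.reverse.take 2 = [((⟨1, hn⟩ : Fin n), false), ((⟨0, by omega⟩ : Fin n), true)] ↔
      (invW w).take 2 = [A2 hn, invL (A1 hn)] := by
    unfold invW
    rw [← List.map_reverse, ← List.map_take]
    have : [A2 hn, invL (A1 hn)] = List.map invL
      [((⟨1, hn⟩ : Fin n), false), ((⟨0, by omega⟩ : Fin n), true)] := by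
      simp [invL, A1, A2]
    rw [this]
    constructor
    · intro h; rw [h]
    · intro h; exact List.map_injective_iff.2 (fun _ _ => invL_inj) h
  simp only [WbarAux, Set.mem_ofPred_eq, ne_eq, badL, not_or, h1, h2]
  simp only [A1, A2, invL, Bool.not_true]
  tauto

theorem T_of_good (hn : 2 ≤ n) {w : Wd n} (h0 : w ≠ []) (h : Red w) (h1 : ¬ badL hn w)
    (h2 : ¬ badL hn (invW w)) : w ∈ TT n hn := by
  have := (mem_aux hn w).2 ⟨h, h1, h2⟩
  refine ⟨?_, by simpa using h0⟩
  by_cases h : w = [((⟨1, hn⟩ : Fin n), true)]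
  · right; simp [h]
  · left; exact ⟨Or.inl this, h⟩

theorem T_single (hn : 2 ≤ n) (s : Fin n × Bool) : [s] ∈ TT n hn := by
  by_cases h1 : s = A1 hn
  · subst h1
    exact ⟨Or.inr (by simp [A1]), by simp⟩
  by_cases h2 : s = invL (A1 hn)
  · subst h2
    exact ⟨Or.inl ⟨Or.inr (by simp [A1, invL]), by simp [A1, invL]⟩, by simp⟩
  apply T_of_good hn
  · simp
  · simp [Red, redB]
  · simp [badL, h1]
  · have : invL s ≠ A1 hn := by rintro h; apply h2; rw [← h, invL_invL]
    simp [badL, invW, this]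

theorem T_red (hn : 2 ≤ n) {w : Wd n} (h : w ∈ TT n hn) : Red w := by
  obtain ⟨h | h, -⟩ := h
  · obtain ⟨h | h, -⟩ := h
    · exact h.1
    · rw [h]; simp [Red, redB]
  · rcases h with h | h <;> rw [h] <;> simp [Red, redB]

theorem T_good (hn : 2 ≤ n) {w : Wd n} (h : w ∈ TT n hn) (hl : 2 ≤ w.length) :
    ¬ badL hn w ∧ ¬ badL hn (invW w) := by
  obtain ⟨h | h, -⟩ := h
  · obtain ⟨h | h, -⟩ := h
    · exact ((mem_aux hn w).1 h).2
    · rw [h] at hl; simp at hl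
  · rcases h with h | h <;> rw [h] at hl <;> simp at hl

/-- Two words with the same tail, both with bad start, agree in the first letter. -/
theorem bad_unique (hn : 2 ≤ n) {x s : Fin n × Bool} {u : Wd n} (hx : Red (x :: u))
    (hs : Red (s :: u)) (bx : badL hn (x :: u)) (bs : badL hn (s :: u)) : s = x := by
  have key : ∀ x s : Fin n × Bool, x = A1 hn → Red (x :: u) →
      (s :: u).take 2 = [A2 hn, invL (A1 hn)] → False := by
    rintro x s rfl hx h
    cases u with
    | nil => simp at h
    | cons b u =>
      simp at h
      exact (red_cons.1 hx).1 h.2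
  rcases bx with bx | bx <;> rcases bs with bs | bs
  · simp at bx bs; rw [bx, bs]
  · simp at bx; exact (key x s bx hx bs).elim
  · simp at bs; exact (key s x bs hs bx).elim
  · simp at bx bs; rw [bx.1, bs.1]

theorem exists_bad (hn : 2 ≤ n) (u : Wd n) (hu : u ≠ []) (hr : Red u) :
    ∃ x, Red (x :: u) ∧ badL hn (x :: u) := by
  cases u with
  | nil => exact absurd rfl hu
  | cons b u =>
    by_cases h : b = invL (A1 hn)
    · refine ⟨A2 hn, red_cons.2 ⟨?_, hr⟩, Or.inr (by simp [h])⟩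
      rw [h]; intro h2; exact A2_ne hn (invL_inj h2).symm
    · exact ⟨A1 hn, red_cons.2 ⟨h, hr⟩, Or.inl (by simp)⟩

/-! ### Spanning -/

theorem step_left {S : Submodule ℚ (Wd n → ℚ)} (hB : bddSub n ≤ S) {x : Fin n × Bool} {u : Wd n}
    (hu : u ≠ []) (hx : Red (x :: u)) (h0 : brooks u ∈ S)
    (h : ∀ s, s ≠ x → Red (s :: u) → brooks (s :: u) ∈ S) : brooks (x :: u) ∈ S := by
  have h1 := hB (brooks_left hu)
  have h2 : x ∈ Finset.univ.filter (fun s => Red (s :: u)) := by simp [hx]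
  rw [← Finset.add_sum_erase _ _ h2] at h1
  have h3 : ∑ s ∈ (Finset.univ.filter (fun s => Red (s :: u))).erase x, brooks (s :: u) ∈ S := by
    apply Submodule.sum_mem
    intro s hs
    simp at hs
    exact h s hs.1 hs.2
  have h4 := S.sub_mem (S.sub_mem h0 h3) h1
  convert h4 using 1
  abel

theorem brooks_mem_inv {S : Submodule ℚ (Wd n → ℚ)} {w : Wd n} (h : brooks (invW w) ∈ S) :
    brooks w ∈ S := by
  rw [brooks_invW] at h
  simpa using h

theorem span_all (hn : 2 ≤ n) {S : Submodule ℚ (Wd n → ℚ)} (hB : bddSub n ≤ S)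
    (hT : ∀ w ∈ TT n hn, brooks w ∈ S) :
    ∀ (k : ℕ) (w : Wd n), w.length = k → Red w → w ≠ [] → brooks w ∈ S := by
  intro k
  induction k with
  | zero => intro w h _ h2; simp at h; exact absurd h h2
  | succ k ih =>
    rcases k with _ | _ | k
    · intro w hw _ _
      obtain ⟨s, rfl⟩ := List.length_eq_one_iff.1 (by simpa using hw)
      exact hT _ (T_single hn s)
    · -- length two
      have good : ∀ x y, Red [x, y] → x ≠ A1 hn → y ≠ invL (A1 hn) → brooks [x, y] ∈ S := by
        intro x y h hx hy
        apply hT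
        have hy' : invL y ≠ A1 hn := by rintro h; apply hy; rw [← h, invL_invL]
        have hx' : invL x ≠ invL (A1 hn) := fun h => hx (invL_inj h)
        apply T_of_good hn (by simp) h
        · simp [badL, hx, hy]
        · simp [badL, invW, hy', hx']
      have bad : ∀ y, Red [A1 hn, y] → brooks [A1 hn, y] ∈ S := by
        intro y h
        apply step_left hB (by simp) h
        · exact ih [y] (by simp) (red_tail h) (by simp)
        · intro s hs hr
          exact good s y hr hs (red_cons.1 h).1
      intro w hw hr _
      obtain ⟨x, y, rfl⟩ := List.length_eq_two.1 (by simpa using hw)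
      by_cases hx : x = A1 hn
      · subst hx; exact bad y hr
      by_cases hy : y = invL (A1 hn)
      · subst hy
        apply brooks_mem_inv
        have := red_invW hr
        simp only [invW, List.map_cons, List.map_nil, List.reverse_cons, List.reverse_nil,
          List.nil_append, List.cons_append, invL_invL] at *
        exact bad _ this
      · exact good x y hr hx hy
    · have stepA : ∀ w : Wd n, w.length = k + 3 → Red w → ¬ badL hn (invW w) → brooks w ∈ S := by
        intro w hw hr hb
        by_cases hl : badL hn w
        · cases w with
          | nil => simp at hw
          | cons x u =>
            have hlu : u.length = k + 2 := by simpa using hw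
            have hu : u ≠ [] := by rintro rfl; simp at hlu
            apply step_left hB hu hr (ih u hlu (red_tail hr) hu)
            intro s hs hrs
            apply hT
            apply T_of_good hn (by simp) hrs
            · intro hb'; exact hs (bad_unique hn hr hrs hl hb')
            · obtain ⟨p, q, t, ht⟩ : ∃ p q t, invW u = p :: q :: t := by
                have := length_invW u
                rcases h : invW u with _ | ⟨p, _ | ⟨q, t⟩⟩
                · rw [h] at this; simp at this; omega
                · rw [h] at this; simp at this; omega
                · exact ⟨p, q, t, rfl⟩
              rw [invW_cons, ht] at hb ⊢
              simpa [badL] using hb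
        · apply hT
          exact T_of_good hn (by rintro rfl; simp at hw) hr hl hb
      intro w hw hr _
      by_cases hb : badL hn (invW w)
      · apply brooks_mem_inv
        have hr' := red_invW hr
        have hw' := (length_invW w).trans hw
        generalize invW w = w' at *
        cases w' with
        | nil => simp at hw'
        | cons x u =>
          have hlu : u.length = k + 2 := by simpa using hw'
          have hu : u ≠ [] := by rintro rfl; simp at hlu
          apply step_left hB hu hr' (ih u hlu (red_tail hr') hu)
          intro s hs hrs
          apply brooks_mem_inv
          apply stepA
          · rw [length_invW]; simp [hlu]
          · exact red_invW hrs
          · rw [invW_invW]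
            intro hb'; exact hs (bad_unique hn hr' hrs hb hb')
      · exact stepA w hw hr hb

/-! ### Independence -/

/-- The counting function with coefficients `c`. -/
noncomputable def cf (c : Wd n →₀ ℚ) (v : Wd n) : ℚ := c.sum (fun w a => a * (occ w v : ℚ))

/-- Sum of the coefficients over prefixes. -/
noncomputable def pf (c : Wd n →₀ ℚ) (v : Wd n) : ℚ := c.sum (fun w a => if w <+: v then a else 0)

theorem cf_cons {c : Wd n →₀ ℚ} (hc : c [] = 0) (a : Fin n × Bool) (v : Wd n) :
    cf c (a :: v) = pf c (a :: v) + cf c v := by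
  unfold cf pf
  rw [← Finsupp.sum_add]
  apply Finsupp.sum_congr
  intro w hw
  have : w ≠ [] := by rintro rfl; simp [hc] at hw
  rw [occ_cons this]
  push_cast
  split_ifs <;> ring

theorem pf_append {c : Wd n →₀ ℚ} {N : ℕ} (hN : ∀ w, c w ≠ 0 → w.length ≤ N) (t s : Wd n)
    (ht : N ≤ t.length) : pf c (t ++ s) = pf c t := by
  unfold pf
  apply Finsupp.sum_congr
  intro w hw
  have h1 := hN w (by simpa using hw)
  have : w <+: t ++ s ↔ w <+: t :=
    ⟨fun h => List.prefix_of_prefix_length_le h (List.prefix_append t s) (h1.trans ht),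
      fun h => h.trans (List.prefix_append t s)⟩
  simp only [this]

theorem pf_concat (c : Wd n →₀ ℚ) (t : Wd n) (y : Fin n × Bool) :
    pf c (t ++ [y]) = pf c t + c (t ++ [y]) := by
  have h : c (t ++ [y]) = c.sum (fun w a => if w = t ++ [y] then a else 0) := by
    rw [Finsupp.sum]
    simp
  rw [h]
  unfold pf
  rw [← Finsupp.sum_add]
  apply Finsupp.sum_congr
  intro w _
  simp only [List.prefix_concat_iff]
  by_cases h1 : w = t ++ [y]
  · have : ¬ w <+: t := by
      intro h; have := h.length_le; rw [h1] at this; simp at this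
    simp [h1, this]
    intro h; have := h.length_le; simp at this
  · simp [h1]

theorem cf_glue {c : Wd n →₀ ℚ} (hc : c [] = 0) {N : ℕ} (hN : ∀ w, c w ≠ 0 → w.length ≤ N)
    (v z r : Wd n) (hz : N ≤ z.length + 1) :
    cf c (v ++ z ++ r) + cf c z = cf c (v ++ z) + cf c (z ++ r) := by
  induction v with
  | nil => simp [add_comm]
  | cons a v ih =>
    have := pf_append hN (a :: (v ++ z)) r (by simp; omega)
    simp only [List.cons_append] at *
    rw [cf_cons hc, cf_cons hc, this]
    linarith

theorem cf_loop {c : Wd n →₀ ℚ} (hc : c [] = 0) {N : ℕ} (hN : ∀ w, c w ≠ 0 → w.length ≤ N)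
    (hb : ∃ C : ℚ, ∀ v, Red v → |cf c v| ≤ C)
    (z w : Wd n) (hz : N ≤ z.length + 1) (hz0 : z ≠ []) (hr : Red (z ++ w ++ z)) :
    cf c (z ++ w ++ z) = cf c z := by
  obtain ⟨C, hC⟩ := hb
  have hzr : Red z := by
    rw [red_iff] at *
    exact (List.isChain_append.1 hr).2.1
  have key : ∀ k : ℕ, ∃ r, Red (z ++ r) ∧
      cf c (z ++ r) = cf c z + k * (cf c (z ++ w ++ z) - cf c z) := by
    intro k
    induction k with
    | zero => exact ⟨[], by simpa using hzr, by simp⟩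
    | succ k ih =>
      obtain ⟨r, h1, h2⟩ := ih
      refine ⟨w ++ z ++ r, ?_, ?_⟩
      · have := red_glue hr h1 hz0
        simpa [List.append_assoc] using this
      · have := cf_glue hc hN (z ++ w) z r hz
        rw [h2] at this
        rw [show z ++ (w ++ z ++ r) = z ++ w ++ z ++ r by simp]
        push_cast
        linarith
  by_contra hne
  set L := cf c (z ++ w ++ z) - cf c z with hL
  have hL0 : 0 < |L| := abs_pos.2 (sub_ne_zero.2 hne)
  obtain ⟨k, hk⟩ := exists_nat_gt ((C + |cf c z|) / |L|)
  rw [div_lt_iff₀ hL0] at hk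
  obtain ⟨r, h1, h2⟩ := key k
  have h3 := hC _ h1
  rw [h2] at h3
  have h4 : |(k : ℚ) * L| ≤ |cf c z + k * L| + |cf c z| := by
    have := abs_sub (cf c z + k * L) (cf c z)
    simpa using this
  rw [abs_mul, Nat.abs_cast] at h4
  linarith

theorem cf_sep (hn : 2 ≤ n) {c : Wd n →₀ ℚ} (hc : c [] = 0)
    (hb : ∃ C : ℚ, ∀ v, Red v → |cf c v| ≤ C) (u : Wd n)
    (hN : ∀ w, c w ≠ 0 → w.length ≤ u.length + 2) :
    ∃ g h : Fin n × Bool → ℚ, ∀ x y, Red (x :: (u ++ [y])) →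
      c (x :: (u ++ [y])) = g x + h y := by
  choose m hm using exists_conn hn
  let a := A1 hn
  let z : Wd n := List.replicate (u.length + 2) a
  have hzl : z.length = u.length + 2 := by simp [z]
  have hz1 : z = List.replicate (u.length + 1) a ++ [a] := List.replicate_succ'
  have hz2 : z = [a] ++ List.replicate (u.length + 1) a := List.replicate_succ
  have hz0 : z ≠ [] := by simp [z]
  have hzr : Red z := by
    rw [red_iff]
    apply List.isChain_replicate_of_rel
    exact (invL_ne a).symm
  refine ⟨fun x => cf c z - cf c (z ++ [m a x] ++ [x] ++ u) + cf c u,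
    fun y => - cf c (u ++ [y] ++ [m y a] ++ z), ?_⟩
  intro x y hxy
  have hred : Red (z ++ ([m a x] ++ [x] ++ u ++ [y] ++ [m y a]) ++ z) := by
    have e1 : Red (z ++ [m a x, x]) := by
      have := red_glue (v := List.replicate (u.length + 1) a) (z := [a]) (r := [m a x, x])
        (by rw [← hz1]; exact hzr) (hm a x) (by simp)
      rwa [← hz1] at this
    have e2 : Red ([y, m y a] ++ z) := by
      have := red_glue (v := [y, m y a]) (z := [a]) (r := List.replicate (u.length + 1) a)
        (hm y a) (by rw [← hz2]; exact hzr) (by simp)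
      rw [hz2]; simpa using this
    have e3 := red_glue (v := z ++ [m a x]) (z := [x]) (r := u ++ [y])
      (by simpa using e1) (by simpa using hxy) (by simp)
    have e4 := red_glue (v := z ++ [m a x] ++ [x] ++ u) (z := [y]) (r := [m y a] ++ z)
      (by simpa using e3) (by simpa using e2) (by simp)
    simpa using e4
  have h1 := cf_loop hc hN hb z _ (by omega) hz0 hred
  have h2 := cf_glue hc hN (z ++ [m a x] ++ [x]) (u ++ [y]) ([m y a] ++ z) (by simp)
  have h3 := cf_glue hc hN (z ++ [m a x]) ([x] ++ u) [y] (by simp)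
  have h4 := cf_cons hc x (u ++ [y])
  have h5 := cf_cons hc x u
  have h6 := pf_concat c (x :: u) y
  simp only [List.append_assoc, List.cons_append, List.nil_append] at *
  linarith

theorem coeff_zero (hn : 2 ≤ n) {c : Wd n →₀ ℚ} (hc : c [] = 0)
    (hb : ∃ C : ℚ, ∀ v, Red v → |cf c v| ≤ C)
    (hanti : ∀ w, c (invW w) = - c w)
    (hred : ∀ w, c w ≠ 0 → Red w)
    (hgood : ∀ w, c w ≠ 0 → 2 ≤ w.length → ¬ badL hn w ∧ ¬ badL hn (invW w)) :
    ∀ N : ℕ, (∀ w, c w ≠ 0 → w.length ≤ N) → ∀ w, c w = 0 := by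
  intro N
  induction N with
  | zero =>
    intro hN w
    by_contra h
    have := hN w h
    simp at this
    exact h (this ▸ hc)
  | succ N ih =>
    intro hN
    suffices h : ∀ w : Wd n, w.length = N + 1 → c w = 0 by
      apply ih
      intro w hw
      have := hN w hw
      have h2 : w.length ≠ N + 1 := fun h' => hw (h w h')
      omega
    rcases N with _ | _ | N
    · intro w hw
      obtain ⟨s, rfl⟩ := List.length_eq_one_iff.1 (by simpa using hw)
      have h1 := cf_loop hc hN hb [s] [] (by simp) (by simp)
        (by simpa [Red, redB] using (invL_ne s).symm)
      have h2 := cf_cons hc s [s]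
      have h3 := pf_append hN [s] [s] (by simp)
      have h4 := pf_concat c [] s
      have h5 := cf_cons hc s []
      have h6 : pf c [] = 0 := by
        unfold pf
        apply Finset.sum_eq_zero
        intro w hw
        simp at hw ⊢
        rintro rfl
        exact hc
      have h7 : cf c [] = 0 := by
        unfold cf
        apply Finset.sum_eq_zero
        intro w hw
        have : w ≠ [] := by rintro rfl; simp [hc] at hw
        simp [occ_nil this]
      simp only [List.append_nil, List.nil_append, List.cons_append] at *
      linarith
    · -- length two
      obtain ⟨g, h, hgh⟩ := cf_sep hn hc hb [] (by simpa using hN)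
      simp only [List.nil_append] at hgh
      -- `m x y` is the coefficient of `x y⁻¹`
      have red2 : ∀ x y : Fin n × Bool, x ≠ y → Red [x, invL y] := by
        intro x y hxy
        rw [red_cons]
        exact ⟨fun h => hxy (invL_inj h).symm, by simp [Red, redB]⟩
      have hm : ∀ x y, x ≠ y → c [x, invL y] = g x + h (invL y) :=
        fun x y hxy => hgh _ _ (red2 x y hxy)
      have anti : ∀ x y, c [y, invL x] = - c [x, invL y] := by
        intro x y
        have := hanti [x, invL y]
        simpa [invW] using this
      have z1 : ∀ y, c [A1 hn, y] = 0 := by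
        intro y
        by_contra hne
        exact (hgood _ hne (by simp)).1 (by simp [badL])
      have ind : ∀ x y t, x ≠ y → x ≠ t → y ≠ A1 hn → t ≠ A1 hn →
          c [x, invL y] = c [x, invL t] := by
        intro x y t h1 h2 h3 h4
        have e1 := hm x y h1
        have e2 := hm x t h2
        have e3 := hm _ y h3.symm
        have e4 := hm _ t h4.symm
        rw [z1] at e3 e4
        linarith
      have main : ∀ x y, x ≠ y → c [x, invL y] = 0 := by
        intro x y hxy
        by_cases hx : x = A1 hn
        · rw [hx]; exact z1 _
        by_cases hy : y = A1 hn
        · rw [hy, anti, z1]; simp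
        obtain ⟨t, ht⟩ : ∃ t : Fin n × Bool, t ∉ ({x, y, A1 hn} : Finset (Fin n × Bool)) := by
          by_contra! h
          have h1 := Finset.card_le_card (show (Finset.univ : Finset (Fin n × Bool)) ⊆ _ from
            fun x _ => h x)
          have h2 := Finset.card_le_three (a := x) (b := y) (c := A1 hn)
          simp at h1
          omega
        simp at ht
        obtain ⟨t1, t2, t3⟩ := ht
        have e1 := ind x y t hxy (Ne.symm t1) hy t3
        have e2 := ind y x t hxy.symm (Ne.symm t2) hx t3
        have e3 := ind t x y t1 t2 hx hy
        have e4 := anti x y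
        have e5 := anti x t
        have e6 := anti y t
        linarith
      intro w hw
      obtain ⟨x, y, rfl⟩ := List.length_eq_two.1 (by simpa using hw)
      by_contra hne
      apply hne
      have hr := hred _ hne
      rw [← invL_invL y]
      apply main
      intro h
      apply (red_cons.1 hr).1
      rw [h, invL_invL]
    · intro w hw
      by_contra hne
      obtain ⟨x, u, y, rfl⟩ : ∃ x u y, w = x :: (u ++ [y]) := by
        cases w with
        | nil => simp at hw
        | cons x t =>
          have : t ≠ [] := by rintro rfl; simp at hw
          exact ⟨x, t.dropLast, t.getLast this, by rw [List.dropLast_append_getLast]⟩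
      have hul : u.length = N + 1 := by simpa using hw
      have hu : u ≠ [] := by rintro rfl; simp at hul
      obtain ⟨g, h, hgh⟩ := cf_sep hn hc hb u (by rw [hul]; exact hN)
      have hr := hred _ hne
      have hru : Red u := by
        rw [red_iff] at *
        exact (List.isChain_append.1 hr.tail).1
      obtain ⟨x', hx', bx'⟩ := exists_bad hn u hu hru
      obtain ⟨y', hy', hby'⟩ := exists_bad hn (invW u) (by simpa [invW_eq_nil] using hu)
        (red_invW hru)
      obtain ⟨b, t, hbt⟩ := List.exists_cons_of_ne_nil hu
      obtain ⟨b', t', hbt'⟩ := List.exists_cons_of_ne_nil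
        (show invW u ≠ [] by simpa [invW_eq_nil] using hu)
      have hy2 : Red (u ++ [invL y']) := by
        have := red_invW hy'
        rwa [invW_cons, invW_invW] at this
      have hxu : Red (x :: u) := by
        rw [red_iff] at *
        exact hr.prefix ⟨[y], by simp⟩
      have R : ∀ p q, Red (p :: u) → Red (u ++ [q]) → Red (p :: (u ++ [q])) := by
        intro p q h1 h2
        have := red_glue (v := [p]) (z := u) (r := [q]) (by simpa using h1) h2 hu
        simpa using this
      have Z1 : ∀ q, c (x' :: (u ++ [q])) = 0 := by
        intro q
        by_contra hne
        apply (hgood _ hne (by simp)).1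
        rw [hbt] at bx' ⊢
        simpa [badL] using bx'
      have Z2 : ∀ p, c (p :: (u ++ [invL y'])) = 0 := by
        intro p
        by_contra hne
        apply (hgood _ hne (by simp)).2
        have e : invW (p :: (u ++ [invL y'])) = y' :: (invW u ++ [invL p]) := by
          simp [invW]
        rw [e]
        rw [hbt'] at hby' ⊢
        simpa [badL] using hby'
      have e1 := hgh _ _ hr
      have e2 := hgh _ _ (R x' y hx' (red_tail hr))
      have e3 := hgh _ _ (R x (invL y') hxu hy2)
      have e4 := hgh _ _ (R x' (invL y') hx' hy2)
      rw [Z1] at e2 e4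
      rw [Z2] at e3
      apply hne
      linarith

end Helpers

/-- Let W_Br' = W̄ ∪ {a₁, a₂} \ {ε} and let W_Br ⊆ W_Br' contain exactly one of each
pair {w, w⁻¹}. Then the classes of the Brooks quasimorphisms φ_w, w ∈ W_Br, form a
basis of the quotient B̂r(F_n) of the Brooks space by bounded functions. -/
theorem stmt_18 (n : ℕ) (hn : 2 ≤ n)
    (WBr : Set (List (Fin n × Bool)))
    (hsub : WBr ⊆ (Wbar n hn ∪
      {[((⟨0, by omega⟩ : Fin n), true)], [((⟨1, hn⟩ : Fin n), true)]}) \ {[]})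
    (htrans : ∀ w ∈ (Wbar n hn ∪
        {[((⟨0, by omega⟩ : Fin n), true)], [((⟨1, hn⟩ : Fin n), true)]}) \ {([] : List (Fin n × Bool))},
      (w ∈ WBr ↔ invW w ∉ WBr)) :
    (∀ f ∈ Submodule.span ℚ
        {g : List (Fin n × Bool) → ℚ | ∃ w, Red w ∧ w ≠ [] ∧ g = brooks w},
      ∃ g ∈ Submodule.span ℚ
          {g : List (Fin n × Bool) → ℚ | ∃ w ∈ WBr, g = brooks w},
        ∃ C : ℚ, ∀ v : List (Fin n × Bool), Red v → |f v - g v| ≤ C) ∧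
    (∀ x : List (Fin n × Bool) →₀ ℚ, (∀ w ∈ x.support, w ∈ WBr) →
      (∃ C : ℚ, ∀ v : List (Fin n × Bool), Red v →
        |∑ u ∈ x.support, x u * brooks u v| ≤ C) → x = 0) := by
  change WBr ⊆ TT n hn at hsub
  change ∀ w ∈ TT n hn, _ at htrans
  constructor
  · intro f hf
    set S0 := Submodule.span ℚ {g : List (Fin n × Bool) → ℚ | ∃ w ∈ WBr, g = brooks w} with hS0
    have hT : ∀ w ∈ TT n hn, brooks w ∈ S0 ⊔ bddSub n := by
      intro w hw
      by_cases h : w ∈ WBr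
      · exact Submodule.mem_sup_left (Submodule.subset_span ⟨w, h, rfl⟩)
      · have h2 : invW w ∈ WBr := by
          by_contra h3; exact h ((htrans w hw).2 h3)
        exact brooks_mem_inv (Submodule.mem_sup_left (Submodule.subset_span ⟨_, h2, rfl⟩))
    have hle : Submodule.span ℚ {g : List (Fin n × Bool) → ℚ | ∃ w, Red w ∧ w ≠ [] ∧ g = brooks w}
        ≤ S0 ⊔ bddSub n := by
      rw [Submodule.span_le]
      rintro g ⟨w, h1, h2, rfl⟩
      exact span_all hn le_sup_right hT _ w rfl h1 h2
    obtain ⟨g, hg, b, ⟨C, hC⟩, rfl⟩ := Submodule.mem_sup.1 (hle hf)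
    refine ⟨g, hg, C, fun v hv => ?_⟩
    simpa using hC v hv
  · intro x hx hbd
    have hinj : Function.Injective (invW (n := n)) := fun a b h => by
      rw [← invW_invW a, h, invW_invW]
    let c : Wd n →₀ ℚ := x - x.mapDomain invW
    have hmd : ∀ w, (x.mapDomain invW) w = x (invW w) := by
      intro w
      have := Finsupp.mapDomain_apply hinj x (invW w)
      rwa [invW_invW] at this
    have hcv : ∀ w, c w = x w - x (invW w) := by
      intro w; simp [c, hmd]
    have hcf : ∀ v, cf c v = ∑ u ∈ x.support, x u * brooks u v := by
      intro v
      unfold cf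
      simp only [c]
      rw [Finsupp.sum_sub_index (by intros; ring), Finsupp.sum_mapDomain_index (by simp)
        (by intros; ring), Finsupp.sum, Finsupp.sum, ← Finset.sum_sub_distrib]
      apply Finset.sum_congr rfl
      intro u _
      simp [brooks]; ring
    have hxT : ∀ w, x w ≠ 0 → w ∈ WBr := fun w hw => hx w (by simpa using hw)
    have hcT : ∀ w, c w ≠ 0 → w ∈ TT n hn ∨ invW w ∈ TT n hn := by
      intro w hw
      rw [hcv] at hw
      by_cases h : x w = 0
      · right; apply hsub; apply hxT; intro h2; simp [h, h2] at hw
      · left; exact hsub (hxT w h)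
    have hzero : ∀ w, c w = 0 := by
      refine coeff_zero hn (c := c) ?_ ?_ ?_ ?_ ?_ (c.support.sup List.length) ?_
      · rw [hcv]; simp [invW]
      · obtain ⟨C, hC⟩ := hbd
        exact ⟨C, fun v hv => by rw [hcf]; exact hC v hv⟩
      · intro w; rw [hcv, hcv, invW_invW]; ring
      · intro w hw
        rcases hcT w hw with h | h
        · exact T_red hn h
        · rw [← invW_invW w]; exact red_invW (T_red hn h)
      · intro w hw hl
        rcases hcT w hw with h | h
        · exact T_good hn h hl
        · have := T_good hn h (by rwa [length_invW])
          rw [invW_invW] at this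
          exact this.symm
      · intro w hw
        exact Finset.le_sup (f := List.length) (by simpa using hw)
    ext w
    by_contra hne
    have h1 := hxT w hne
    have h2 := (htrans w (hsub h1)).1 h1
    have h3 : x (invW w) = 0 := by
      by_contra h; exact h2 (hxT _ h)
    have h4 := hzero w
    rw [hcv, h3, sub_zero] at h4
    exact hne h4
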